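/- arXiv:2403.10626 — 2 statements merged into one kernel-verified Lean document; each statement's English description precedes it below -/
import Mathlib

section
/- Let A be a symmetric n×n integer matrix with even diagonal entries such that A modulo 4 equals diag(r·[[2,1],[1,2]], s·[[0,1],[1,0]], t·[[0,2],[2,0]], p·[2], m·[0]) with p = 0 (so the radical V̄₀ of A mod 2 satisfies q(V̄₀) = 0). Then the Arf invariant of the associated quadratic form q satisfies Arf(q) ≡ r mod 2. -/
/-- Entry `(i,j)` of the block diagonal matrix
`diag(r·[[2,1],[1,2]], s·[[0,1],[1,0]], t·[[0,2],[2,0]], p·[2], m·[0])`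
(the `m` trailing zero rows/columns are implicit: the entry is `0` there). -/
def nfEntry (r s t p : ℕ) (i j : ℕ) : ℤ :=
  if i < 2*r ∧ j < 2*r then (if i = j then 2 else if i / 2 = j / 2 then 1 else 0)
  else if 2*r ≤ i ∧ i < 2*r+2*s ∧ 2*r ≤ j ∧ j < 2*r+2*s then
    (if i ≠ j ∧ i / 2 = j / 2 then 1 else 0)
  else if 2*r+2*s ≤ i ∧ i < 2*r+2*s+2*t ∧ 2*r+2*s ≤ j ∧ j < 2*r+2*s+2*t then
    (if i ≠ j ∧ i / 2 = j / 2 then 2 else 0)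
  else if 2*r+2*s+2*t ≤ i ∧ i < 2*r+2*s+2*t+p ∧ i = j then 2
  else 0

open Matrix in
/-- The quadratic form over `𝔽₂` associated with a symmetric integer matrix `A`
with even diagonal entries: `q(v) = (ṽᵀ A ṽ)/2 (mod 2)`, computed on the
canonical integer lift `ṽ` of `v` (it is independent of the chosen lift). -/
def qf {n : ℕ} (A : Matrix (Fin n) (Fin n) ℤ) (v : Fin n → ZMod 2) : ZMod 2 :=
  ((((fun i => ((v i).val : ℤ)) ⬝ᵥ A.mulVec (fun i => ((v i).val : ℤ))) / 2 : ℤ) : ZMod 2)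

def chi2 (a : ZMod 2) : ℤ := if a = 0 then 1 else -1

lemma chi2_add : ∀ a b : ZMod 2, chi2 (a + b) = chi2 a * chi2 b := by decide

lemma chi2_sum {ι : Type*} (s : Finset ι) (g : ι → ZMod 2) :
    chi2 (∑ i ∈ s, g i) = ∏ i ∈ s, chi2 (g i) := by
  classical
  induction s using Finset.induction_on with
  | empty => simp [chi2]
  | insert a s ha ih => rw [Finset.sum_insert ha, Finset.prod_insert ha, chi2_add, ih]

lemma q_sum_orth {V ι : Type*} [AddCommGroup V] [Module (ZMod 2) V]
    (q : V → ZMod 2) (B : V →ₗ[ZMod 2] V →ₗ[ZMod 2] ZMod 2)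
    (hq0 : q 0 = 0) (hq : ∀ u v, q (u + v) = q u + q v + B u v)
    (s : Finset ι) (w : ι → V) (hw : ∀ i j, i ≠ j → B (w i) (w j) = 0) :
    q (∑ i ∈ s, w i) = ∑ i ∈ s, q (w i) := by
  classical
  induction s using Finset.induction_on with
  | empty => simpa using hq0
  | insert a s ha ih =>
    rw [Finset.sum_insert ha, Finset.sum_insert ha, hq, ih, map_sum,
      Finset.sum_eq_zero (s := s) (f := fun i => B (w a) (w i)), add_zero]
    intro i hi
    exact hw a i (fun h => ha (h ▸ hi))

lemma q_smul {V : Type*} [AddCommGroup V] [Module (ZMod 2) V]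
    (q : V → ZMod 2) (hq0 : q 0 = 0) (a : ZMod 2) (u : V) : q (a • u) = a * q u := by
  have : a = 0 ∨ a = 1 := by revert a; decide
  rcases this with rfl | rfl <;> simp [hq0]

lemma pair_sum : ∀ x y : ZMod 2,
    ∑ p : ZMod 2 × ZMod 2, chi2 (p.1 * x + p.2 * y + p.1 * p.2) = 2 * chi2 (x * y) := by
  decide

lemma single_sum : ∀ x : ZMod 2, ∑ c : ZMod 2, chi2 (c * x) = 1 + chi2 x := by decide

lemma gauss {n : ℕ} {ι κ : Type*} [Fintype ι] [Fintype κ]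
    (q : (Fin n → ZMod 2) → ZMod 2)
    (B : (Fin n → ZMod 2) →ₗ[ZMod 2] (Fin n → ZMod 2) →ₗ[ZMod 2] ZMod 2)
    (hq0 : q 0 = 0) (hq : ∀ u v, q (u + v) = q u + q v + B u v)
    (hsymm : ∀ u v, B u v = B v u)
    (e f : ι → (Fin n → ZMod 2)) (h : κ → (Fin n → ZMod 2))
    (hcount : 2 * Fintype.card ι + Fintype.card κ = n)
    (hbasis : LinearIndependent (ZMod 2) (Sum.elim e (Sum.elim f h)))
    (hef : ∀ i, B (e i) (f i) = 1)
    (hef' : ∀ i j, i ≠ j → B (e i) (f j) = 0)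
    (hee : ∀ i j, B (e i) (e j) = 0)
    (hff : ∀ i j, B (f i) (f j) = 0)
    (heh : ∀ i j, B (e i) (h j) = 0)
    (hfh : ∀ i j, B (f i) (h j) = 0)
    (hhh : ∀ i j, B (h i) (h j) = 0) :
    ∑ v, chi2 (q v) = 2 ^ Fintype.card ι * chi2 (∑ i, q (e i) * q (f i)) *
      ∏ j, (1 + chi2 (q (h j))) := by
  classical
  let w1 : (ι → ZMod 2 × ZMod 2) → ι → (Fin n → ZMod 2) :=
    fun g i => (g i).1 • e i + (g i).2 • f i
  let w2 : (κ → ZMod 2) → κ → (Fin n → ZMod 2) := fun c j => c j • h j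
  let Φ : (ι → ZMod 2 × ZMod 2) × (κ → ZMod 2) → (Fin n → ZMod 2) :=
    fun d => ∑ i, w1 d.1 i + ∑ j, w2 d.2 j
  have hinj : Function.Injective Φ := by
    intro d d' hd
    have key := Fintype.linearIndependent_iff.1 hbasis
      (Sum.elim (fun i => (d.1 i).1 - (d'.1 i).1)
        (Sum.elim (fun i => (d.1 i).2 - (d'.1 i).2) (fun j => d.2 j - d'.2 j))) (by
        have hd2 := sub_eq_zero.2 hd
        simp only [Φ, w1, w2, Finset.sum_add_distrib] at hd2
        simp only [Fintype.sum_sum_type, Sum.elim_inl, Sum.elim_inr, sub_smul,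
          Finset.sum_sub_distrib]
        rw [← hd2]; abel)
    refine Prod.ext (funext fun i => Prod.ext ?_ ?_) (funext fun j => ?_)
    · exact sub_eq_zero.1 (key (Sum.inl i))
    · exact sub_eq_zero.1 (key (Sum.inr (Sum.inl i)))
    · exact sub_eq_zero.1 (key (Sum.inr (Sum.inr j)))
  have hbij : Function.Bijective Φ := by
    rw [Fintype.bijective_iff_injective_and_card]
    refine ⟨hinj, ?_⟩
    simp only [Fintype.card_prod, Fintype.card_fun, ZMod.card, Fintype.card_fin]
    rw [← hcount, pow_add, pow_mul]
    norm_num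
  have hval : ∀ d, chi2 (q (Φ d)) =
      (∏ i, chi2 ((d.1 i).1 * q (e i) + (d.1 i).2 * q (f i) + (d.1 i).1 * (d.1 i).2)) *
      ∏ j, chi2 (d.2 j * q (h j)) := by
    intro d
    have h12 : B (∑ i, w1 d.1 i) (∑ j, w2 d.2 j) = 0 := by
      simp [w1, w2, map_sum, LinearMap.sum_apply, heh, hfh]
    have hfe : ∀ i j, i ≠ j → B (f i) (e j) = 0 := fun i j hij => by
      rw [hsymm]; exact hef' j i hij.symm
    rw [hq, h12, add_zero, chi2_add,
      q_sum_orth q B hq0 hq _ _ (by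
        intro i j hij
        simp [w1, hee, hff, hef' i j hij, hfe i j hij]),
      q_sum_orth q B hq0 hq _ _ (by
        intro i j hij
        simp [w2, hhh]), chi2_sum, chi2_sum]
    congr 1
    · refine Finset.prod_congr rfl fun i _ => ?_
      simp only [w1]
      rw [hq, q_smul q hq0, q_smul q hq0]
      simp [hef, mul_comm]
    · refine Finset.prod_congr rfl fun i _ => ?_
      simp only [w2]
      rw [q_smul q hq0]
  rw [← hbij.sum_comp (fun v => chi2 (q v))]
  simp only [hval]
  rw [Fintype.sum_prod_type]
  dsimp only
  rw [← Finset.sum_mul_sum,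
    ← Fintype.prod_sum (fun i (p : ZMod 2 × ZMod 2) =>
      chi2 (p.1 * q (e i) + p.2 * q (f i) + p.1 * p.2)),
    ← Fintype.prod_sum (fun j (c : ZMod 2) => chi2 (c * q (h j)))]
  simp only [pair_sum, single_sum, Finset.prod_mul_distrib, chi2_sum, Finset.prod_const,
    Finset.card_univ]

open Matrix in
lemma Q_even {n : ℕ} (A : Matrix (Fin n) (Fin n) ℤ)
    (hsym : A.IsSymm) (hdiag : ∀ i, Even (A i i)) (x : Fin n → ℤ) :
    (2 : ℤ) ∣ x ⬝ᵥ A.mulVec x := by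
  have h2 : (((x ⬝ᵥ A.mulVec x : ℤ)) : ZMod 2) = 0 := by
    simp only [dotProduct, mulVec, Finset.mul_sum]
    rw [← Finset.sum_product', Int.cast_sum]
    refine Finset.sum_involution (fun p _ => p.swap) ?_ ?_ ?_ ?_
    · rintro ⟨i, j⟩ _
      have : A j i = A i j := hsym.apply i j
      simp only [Prod.swap, this]
      push_cast
      have h20 : (2 : ZMod 2) = 0 := rfl
      linear_combination (x i * A i j * x j : ZMod 2) * h20
    · rintro ⟨i, j⟩ _ hne heq
      apply hne
      have : j = i := congrArg Prod.fst heq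
      subst this
      have := (ZMod.intCast_zmod_eq_zero_iff_dvd (A j j) 2).2 (by exact_mod_cast (hdiag j).two_dvd)
      simp [this]
    · simp
    · simp
  exact_mod_cast (ZMod.intCast_zmod_eq_zero_iff_dvd _ 2).1 h2

open Matrix in
lemma Q_half_add {n : ℕ} (A : Matrix (Fin n) (Fin n) ℤ)
    (hsym : A.IsSymm) (hdiag : ∀ i, Even (A i i)) (x y : Fin n → ℤ) :
    ((x + y) ⬝ᵥ A.mulVec (x + y)) / 2 =
      (x ⬝ᵥ A.mulVec x) / 2 + (y ⬝ᵥ A.mulVec y) / 2 + x ⬝ᵥ A.mulVec y := by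
  have h1 := Q_even A hsym hdiag x
  have h2 := Q_even A hsym hdiag y
  have h3 : y ⬝ᵥ A.mulVec x = x ⬝ᵥ A.mulVec y := by
    rw [dotProduct_mulVec, ← mulVec_transpose, hsym.eq, dotProduct_comm]
  have h4 : (x + y) ⬝ᵥ A.mulVec (x + y) =
      x ⬝ᵥ A.mulVec x + y ⬝ᵥ A.mulVec y + 2 * (x ⬝ᵥ A.mulVec y) := by
    rw [mulVec_add, dotProduct_add, add_dotProduct, add_dotProduct, h3]; ring
  omega

open Matrix in
lemma qf_lift {n : ℕ} (A : Matrix (Fin n) (Fin n) ℤ)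
    (hsym : A.IsSymm) (hdiag : ∀ i, Even (A i i)) (x : Fin n → ℤ) (v : Fin n → ZMod 2)
    (hx : ∀ i, (x i : ZMod 2) = v i) :
    qf A v = ((x ⬝ᵥ A.mulVec x / 2 : ℤ) : ZMod 2) := by
  have : ∀ i, ∃ z : ℤ, ((v i).val : ℤ) = x i + 2 * z := by
    intro i
    have h1 : (((v i).val : ℤ) : ZMod 2) = (x i : ZMod 2) := by
      rw [hx]; simp
    have h2 := (ZMod.intCast_eq_intCast_iff_dvd_sub _ _ 2).1 h1.symm
    obtain ⟨z, hz⟩ := h2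
    exact ⟨z, by push_cast at hz ⊢; linarith⟩
  choose z hz using this
  have hz' : (fun i => ((v i).val : ℤ)) = x + (2 : ℤ) • z := by
    funext i; simp [hz]
  unfold qf
  rw [hz', Q_half_add A hsym hdiag]
  have h5 : ((2 : ℤ) • z) ⬝ᵥ A.mulVec ((2 : ℤ) • z) / 2 = 2 * (z ⬝ᵥ A.mulVec z) := by
    rw [mulVec_smul, dotProduct_smul, smul_dotProduct, smul_eq_mul, smul_eq_mul]; omega
  rw [h5, mulVec_smul, dotProduct_smul, smul_eq_mul]
  have h20 : (2 : ZMod 2) = 0 := rfl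
  push_cast
  rw [h20]; ring

open Matrix in
lemma qf_add {n : ℕ} (A : Matrix (Fin n) (Fin n) ℤ)
    (hsym : A.IsSymm) (hdiag : ∀ i, Even (A i i)) (u v : Fin n → ZMod 2) :
    qf A (u + v) = qf A u + qf A v + u ⬝ᵥ (A.map (Int.cast : ℤ → ZMod 2)).mulVec v := by
  rw [qf_lift A hsym hdiag ((fun i => ((u i).val : ℤ)) + (fun i => ((v i).val : ℤ))) (u + v)
    (by intro i; simp), Q_half_add A hsym hdiag]
  push_cast
  unfold qf
  congr 1
  simp [dotProduct, mulVec]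

open Matrix in
lemma qf_single {n : ℕ} (A : Matrix (Fin n) (Fin n) ℤ)
    (hsym : A.IsSymm) (hdiag : ∀ i, Even (A i i)) (i : Fin n) :
    qf A (Pi.single i 1) = ((A i i / 2 : ℤ) : ZMod 2) := by
  rw [qf_lift A hsym hdiag (Pi.single i 1) _ (by
    intro j
    by_cases hj : j = i
    · subst hj; simp
    · simp [hj])]
  simp

lemma chi2_inj_pos : ∀ a b : ZMod 2, ∀ x y : ℤ, 0 ≤ x → 0 < y →
    x * chi2 a = y * chi2 b → a = b := by
  intro a b x y hx hy hxy
  have h01 : ∀ a : ZMod 2, a = 0 ∨ a = 1 := by decide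
  have ha := h01 a
  have hb := h01 b
  rcases ha with rfl | rfl <;> rcases hb with rfl | rfl <;> simp [chi2] at hxy ⊢ <;> omega

open Matrix in
/-- Lemma 2.8(iv): if A is congruent mod 4 to the normal form with p = 0, then
for any symplectic basis {e₁,f₁,…,e_k,f_k,h₁,…,h_l} of 𝔽₂ⁿ for the bilinear
form Ω(u,v) = uᵀAv (mod 2), the Arf invariant Σ q(eᵢ)q(fᵢ) of the associated
quadratic form q is congruent to r modulo 2. -/
theorem stmt_11 (n r s t m k l : ℕ) (A : Matrix (Fin n) (Fin n) ℤ)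
    (hsym : A.IsSymm) (hdiag : ∀ i, Even (A i i))
    (hn : n = 2*r + 2*s + 2*t + m)
    (hA : ∀ i j : Fin n,
      ((A i j : ℤ) : ZMod 4) = ((nfEntry r s t 0 (i : ℕ) (j : ℕ) : ℤ) : ZMod 4))
    (e f : Fin k → (Fin n → ZMod 2)) (h : Fin l → (Fin n → ZMod 2))
    (hcount : 2*k + l = n)
    (hbasis : LinearIndependent (ZMod 2) (Sum.elim e (Sum.elim f h)))
    (hef : ∀ i j, e i ⬝ᵥ (A.map (Int.cast : ℤ → ZMod 2)).mulVec (f j)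
            = if i = j then 1 else 0)
    (hee : ∀ i j, e i ⬝ᵥ (A.map (Int.cast : ℤ → ZMod 2)).mulVec (e j) = 0)
    (hff : ∀ i j, f i ⬝ᵥ (A.map (Int.cast : ℤ → ZMod 2)).mulVec (f j) = 0)
    (heh : ∀ i j, e i ⬝ᵥ (A.map (Int.cast : ℤ → ZMod 2)).mulVec (h j) = 0)
    (hfh : ∀ i j, f i ⬝ᵥ (A.map (Int.cast : ℤ → ZMod 2)).mulVec (h j) = 0)
    (hhh : ∀ i j, h i ⬝ᵥ (A.map (Int.cast : ℤ → ZMod 2)).mulVec (h j) = 0) :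
    (∑ i : Fin k, qf A (e i) * qf A (f i)) = (r : ZMod 2) := by
  classical
  let B : (Fin n → ZMod 2) →ₗ[ZMod 2] (Fin n → ZMod 2) →ₗ[ZMod 2] ZMod 2 :=
    Matrix.toLinearMap₂' (ZMod 2) (A.map (Int.cast : ℤ → ZMod 2))
  have hB : ∀ u v, B u v = u ⬝ᵥ (A.map (Int.cast : ℤ → ZMod 2)).mulVec v := fun u v =>
    Matrix.toLinearMap₂'_apply' _ _ _
  have hBs : ∀ u v, B u v = B v u := by
    intro u v
    rw [hB, hB, dotProduct_mulVec, ← mulVec_transpose, ← transpose_map, hsym.eq, dotProduct_comm]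
  have hq0 : qf A 0 = 0 := by simp [qf, dotProduct]
  have hq : ∀ u v, qf A (u + v) = qf A u + qf A v + B u v := fun u v => by
    rw [hB]; exact qf_add A hsym hdiag u v
  have G1 := gauss (qf A) B hq0 hq hBs e f h (by simpa using hcount) hbasis
    (fun i => by rw [hB, hef]; simp) (fun i j hij => by rw [hB, hef]; simp [hij])
    (fun i j => by rw [hB, hee]) (fun i j => by rw [hB, hff]) (fun i j => by rw [hB, heh])
    (fun i j => by rw [hB, hfh]) (fun i j => by rw [hB, hhh])
  have hA4 : ∀ i j : Fin n, (4 : ℤ) ∣ nfEntry r s t 0 i j - A i j := fun i j => by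
    exact_mod_cast (ZMod.intCast_eq_intCast_iff_dvd_sub _ _ 4).1 (hA i j)
  let E : Fin (r + s) → Fin n := fun i => ⟨2 * i, by omega⟩
  let F : Fin (r + s) → Fin n := fun i => ⟨2 * i + 1, by omega⟩
  let H : Fin (2 * t + m) → Fin n := fun i => ⟨2 * r + 2 * s + i, by omega⟩
  let b : Fin n → (Fin n → ZMod 2) := fun i => Pi.single i 1
  have hBb : ∀ i j, B (b i) (b j) = ((nfEntry r s t 0 i j : ℤ) : ZMod 2) := by
    intro i j
    have h1 : B (b i) (b j) = ((A i j : ℤ) : ZMod 2) := by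
      rw [hB]; simp [b]
    rw [h1, ZMod.intCast_eq_intCast_iff_dvd_sub]
    exact (by norm_num : ((2 : ℕ) : ℤ) ∣ 4).trans (hA4 i j)
  have hqb : ∀ i, qf A (b i) = ((nfEntry r s t 0 i i / 2 : ℤ) : ZMod 2) := by
    intro i
    rw [qf_single A hsym hdiag, ZMod.intCast_eq_intCast_iff_dvd_sub]
    have h1 := hA4 i i
    have h2 := (hdiag i).two_dvd
    push_cast
    omega
  have hlin : LinearIndependent (ZMod 2) (Sum.elim (b ∘ E) (Sum.elim (b ∘ F) (b ∘ H))) := by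
    have h1 : LinearIndependent (ZMod 2) b := by
      have := (Pi.basisFun (ZMod 2) (Fin n)).linearIndependent
      convert this using 1
      funext i; simp [b]
    have h2 : Function.Injective (Sum.elim E (Sum.elim F H)) := by
      rintro (i | i | i) (j | j | j) hij <;>
        simp only [Sum.elim_inl, Sum.elim_inr, E, F, H, Fin.mk.injEq] at hij <;>
        first
          | (exfalso; omega)
          | (congr 2; apply Fin.ext; omega)
          | (congr 1; apply Fin.ext; omega)
    have h3 := h1.comp _ h2
    rwa [Sum.comp_elim, Sum.comp_elim] at h3
  have G2 := gauss (qf A) B hq0 hq hBs (b ∘ E) (b ∘ F) (b ∘ H) (by simp; omega) hlin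
    (fun i => by
      have : nfEntry r s t 0 (E i) (F i) = 1 := by
        simp only [E, F, nfEntry]; split_ifs <;> omega
      simp [hBb, this])
    (fun i j hij => by
      have hij' : (i : ℕ) ≠ j := fun h => hij (Fin.ext h)
      have : nfEntry r s t 0 (E i) (F j) = 0 := by
        simp only [E, F, nfEntry]; split_ifs <;> omega
      simp [hBb, this])
    (fun i j => by
      have : (2 : ℤ) ∣ nfEntry r s t 0 (E i) (E j) := by
        simp only [E, F, nfEntry]; split_ifs <;> omega
      simpa [hBb] using (ZMod.intCast_zmod_eq_zero_iff_dvd _ 2).2 this)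
    (fun i j => by
      have : (2 : ℤ) ∣ nfEntry r s t 0 (F i) (F j) := by
        simp only [E, F, nfEntry]; split_ifs <;> omega
      simpa [hBb] using (ZMod.intCast_zmod_eq_zero_iff_dvd _ 2).2 this)
    (fun i j => by
      have : (2 : ℤ) ∣ nfEntry r s t 0 (E i) (H j) := by
        simp only [E, H, nfEntry]; split_ifs <;> omega
      simpa [hBb] using (ZMod.intCast_zmod_eq_zero_iff_dvd _ 2).2 this)
    (fun i j => by
      have : (2 : ℤ) ∣ nfEntry r s t 0 (F i) (H j) := by
        simp only [F, H, nfEntry]; split_ifs <;> omega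
      simpa [hBb] using (ZMod.intCast_zmod_eq_zero_iff_dvd _ 2).2 this)
    (fun i j => by
      have : (2 : ℤ) ∣ nfEntry r s t 0 (H i) (H j) := by
        simp only [H, nfEntry]; split_ifs <;> omega
      simpa [hBb] using (ZMod.intCast_zmod_eq_zero_iff_dvd _ 2).2 this)
  have hArf : ∑ i, qf A ((b ∘ E) i) * qf A ((b ∘ F) i) = (r : ZMod 2) := by
    have : ∀ i : Fin (r + s), qf A ((b ∘ E) i) * qf A ((b ∘ F) i) =
        if (i : ℕ) < r then 1 else 0 := by
      intro i
      simp only [Function.comp, hqb]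
      split_ifs with hi
      · have h1 : nfEntry r s t 0 (E i) (E i) = 2 := by
          simp only [E, nfEntry]; split_ifs <;> omega
        have h2 : nfEntry r s t 0 (F i) (F i) = 2 := by
          simp only [F, nfEntry]; split_ifs <;> omega
        simp [h1, h2]
      · have h1 : nfEntry r s t 0 (E i) (E i) = 0 := by
          simp only [E, nfEntry]; split_ifs <;> omega
        simp [h1]
    rw [Finset.sum_congr rfl (fun i _ => this i), Fin.sum_univ_add]
    simp
  have hH : ∀ j, qf A ((b ∘ H) j) = 0 := by
    intro j
    have h1 : nfEntry r s t 0 (H j) (H j) = 0 := by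
      simp only [H, nfEntry]; split_ifs <;> omega
    simp [hqb, h1]
  rw [G1, hArf] at G2
  simp only [hH] at G2
  have hnn : ∀ a : ZMod 2, 0 ≤ 1 + chi2 a := by decide
  refine chi2_inj_pos _ _ (2 ^ Fintype.card (Fin k) * ∏ j, (1 + chi2 (qf A (h j))))
    (2 ^ Fintype.card (Fin (r + s)) * ∏ j : Fin (2 * t + m), (1 + chi2 0)) ?_ ?_ ?_
  · exact mul_nonneg (by positivity) (Finset.prod_nonneg fun j _ => hnn _)
  · exact mul_pos (by positivity) (Finset.prod_pos fun j _ => by decide)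
  · linear_combination G2
end

section
/- Let A and A' be symmetric integer matrices whose reductions modulo 4 are in the normal form diag(r·[[2,1],[1,2]], s·[[0,1],[1,0]], t·[[0,2],[2,0]], p·[2], m·[0]) and the analogous form with parameters (r',s',t',p',m'). Then there exists an integer matrix P with det(P) = ±1 and P^T A P ≡ A' mod 4 if and only if m = m' and the associated 𝔽₂-quadratic forms q_A and q_{A'} are isomorphic. -/
open Matrix in

theorem peelEquiv {V K : Type} [AddCommGroup V] [Module (ZMod 2) V] [AddCommGroup K] [Module (ZMod 2) K]
    (ι : K →ₗ[ZMod 2] V) (ρ : V →ₗ[ZMod 2] K) (h1 : ∀ k, ρ (ι k) = k) :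
    ∃ e : V ≃ₗ[ZMod 2] K × LinearMap.ker ρ, ∀ k w, e.symm (k, w) = ι k + w := by
  refine ⟨LinearEquiv.symm
    { toFun := fun x => ι x.1 + x.2
      map_add' := ?_
      map_smul' := ?_
      invFun := fun v => (ρ v, ⟨v - ι (ρ v), by simp [h1]⟩)
      left_inv := ?_
      right_inv := ?_ }, ?_⟩
  · intro x y; simp; abel
  · intro c x; simp
  · rintro ⟨k, w, hw⟩
    have : ρ w = 0 := hw
    simp [h1, this]
  · intro v; simp
  · intro k w; rfl

theorem peelStep {V V' K : Type} [AddCommGroup V] [Module (ZMod 2) V] [AddCommGroup V'] [Module (ZMod 2) V']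
    [AddCommGroup K] [Module (ZMod 2) K]
    [FiniteDimensional (ZMod 2) V] [FiniteDimensional (ZMod 2) V'] [FiniteDimensional (ZMod 2) K]
    (B : V →ₗ[ZMod 2] V →ₗ[ZMod 2] ZMod 2) (B' : V' →ₗ[ZMod 2] V' →ₗ[ZMod 2] ZMod 2)
    (hs : ∀ x y, B x y = B y x) (hs' : ∀ x y, B' x y = B' y x)
    (hd : Module.finrank (ZMod 2) V = Module.finrank (ZMod 2) V')
    (hk : Module.finrank (ZMod 2) (LinearMap.ker B) = Module.finrank (ZMod 2) (LinearMap.ker B'))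
    (hK : 0 < Module.finrank (ZMod 2) K)
    (IH : ∀ (W W' : Type) [AddCommGroup W] [Module (ZMod 2) W] [AddCommGroup W'] [Module (ZMod 2) W']
      [FiniteDimensional (ZMod 2) W] [FiniteDimensional (ZMod 2) W']
      (C : W →ₗ[ZMod 2] W →ₗ[ZMod 2] ZMod 2) (C' : W' →ₗ[ZMod 2] W' →ₗ[ZMod 2] ZMod 2),
      (∀ x y, C x y = C y x) → (∀ x y, C' x y = C' y x) →
      Module.finrank (ZMod 2) W < Module.finrank (ZMod 2) V →
      Module.finrank (ZMod 2) W = Module.finrank (ZMod 2) W' →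
      Module.finrank (ZMod 2) (LinearMap.ker C) = Module.finrank (ZMod 2) (LinearMap.ker C') →
      ((∀ x, C x x = 0) ↔ (∀ x, C' x x = 0)) →
      ∃ φ : W ≃ₗ[ZMod 2] W', ∀ x y, C' (φ x) (φ y) = C x y)
    (ι : K →ₗ[ZMod 2] V) (ρ : V →ₗ[ZMod 2] K) (ι' : K →ₗ[ZMod 2] V') (ρ' : V' →ₗ[ZMod 2] K)
    (G : K → K → ZMod 2) (hG : ∀ k, G k 0 = 0)
    (h1 : ∀ k, ρ (ι k) = k) (h1' : ∀ k, ρ' (ι' k) = k)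
    (h2 : ∀ k v, B (ι k) v = G k (ρ v)) (h2' : ∀ k v, B' (ι' k) v = G k (ρ' v))
    (hρ : ∀ v, (∀ w, B v w = 0) → ρ v = 0) (hρ' : ∀ v, (∀ w, B' v w = 0) → ρ' v = 0)
    (ha : ¬ (∀ x, ρ x = 0 → ∀ y, ρ y = 0 → B x y = 0) →
      ¬ (∀ x, ρ' x = 0 → ∀ y, ρ' y = 0 → B' x y = 0) →
      ((∀ x, ρ x = 0 → B x x = 0) ↔ (∀ x, ρ' x = 0 → B' x x = 0))) :
    ∃ φ : V ≃ₗ[ZMod 2] V', ∀ x y, B' (φ x) (φ y) = B x y := by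
  have key : ∀ {V : Type} [AddCommGroup V] [Module (ZMod 2) V] [FiniteDimensional (ZMod 2) V]
      (B : V →ₗ[ZMod 2] V →ₗ[ZMod 2] ZMod 2) (hs : ∀ x y, B x y = B y x)
      (ι : K →ₗ[ZMod 2] V) (ρ : V →ₗ[ZMod 2] K) (h1 : ∀ k, ρ (ι k) = k)
      (h2 : ∀ k v, B (ι k) v = G k (ρ v)) (hρ : ∀ v, (∀ w, B v w = 0) → ρ v = 0),
      ∃ (C : LinearMap.ker ρ →ₗ[ZMod 2] LinearMap.ker ρ →ₗ[ZMod 2] ZMod 2)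
        (e : V ≃ₗ[ZMod 2] K × LinearMap.ker ρ), (∀ x y, C x y = B x y) ∧
        Module.finrank (ZMod 2) (LinearMap.ker C) = Module.finrank (ZMod 2) (LinearMap.ker B) ∧
        Module.finrank (ZMod 2) V = Module.finrank (ZMod 2) K + Module.finrank (ZMod 2) (LinearMap.ker ρ) ∧
        ∀ a b, B (e.symm a) (e.symm b) = G a.1 b.1 + C a.2 b.2 := by
    intro V _ _ _ B hs ι ρ h1 h2 hρ
    obtain ⟨e, he⟩ := peelEquiv ι ρ h1
    have horth : ∀ k (w : LinearMap.ker ρ), B (ι k) w = 0 := by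
      intro k w
      rw [h2, show ρ w = 0 from w.2, hG]
    refine ⟨B.domRestrict₁₂ _ _, e, fun x y => rfl, ?_, ?_, ?_⟩
    · have hm : (LinearMap.ker (B.domRestrict₁₂ (LinearMap.ker ρ) (LinearMap.ker ρ))).map
          (LinearMap.ker ρ).subtype = LinearMap.ker B := by
        ext v
        simp only [Submodule.mem_map, LinearMap.mem_ker]
        constructor
        · rintro ⟨w, hw, rfl⟩
          ext v
          obtain ⟨⟨k, u⟩, rfl⟩ := e.symm.surjective v
          rw [he]
          have := LinearMap.congr_fun hw u
          simp only [LinearMap.domRestrict₁₂_apply, LinearMap.zero_apply] at this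
          simp [this, hs _ (ι k), horth]
        · intro hv
          refine ⟨⟨v, hρ v (fun w => by rw [hv]; rfl)⟩, ?_, rfl⟩
          ext u
          rw [LinearMap.domRestrict₁₂_apply]
          simp [hv]
      rw [← hm]
      exact (Submodule.finrank_map_subtype_eq _ _).symm
    · rw [e.finrank_eq, Module.finrank_prod]
    · rintro ⟨k, u⟩ ⟨l, w⟩
      simp only [he, map_add, LinearMap.add_apply, horth, hs _ (ι l), LinearMap.domRestrict₁₂_apply]
      rw [hs (ι l), h2, h1]
      ring
  obtain ⟨C, e, hC, hCk, hCd, hCe⟩ := key B hs ι ρ h1 h2 hρ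
  obtain ⟨C', e', hC', hCk', hCd', hCe'⟩ := key B' hs' ι' ρ' h1' h2' hρ'
  have zz : ∀ {W : Type} [AddCommGroup W] [Module (ZMod 2) W] [FiniteDimensional (ZMod 2) W]
     (C : W →ₗ[ZMod 2] W →ₗ[ZMod 2] ZMod 2), (∀ x y, C x y = 0) ↔ 
     Module.finrank (ZMod 2) (LinearMap.ker C) = Module.finrank (ZMod 2) W := by
    intro W _ _ _ C
    constructor
    · intro h
      have : LinearMap.ker C = ⊤ := by
        rw [LinearMap.ker_eq_top]; ext x y; exact h x y
      rw [this, finrank_top]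
    · intro h
      have := Submodule.eq_top_of_finrank_eq h
      rw [LinearMap.ker_eq_top] at this
      intro x y; rw [this]; rfl
  have hz : (∀ x y, C x y = 0) ↔ (∀ x y, C' x y = 0) := by
    rw [zz, zz]; omega
  have ha1 : ((∀ x, C x x = 0) ↔ (∀ x, C' x x = 0)) := by
    have e1 : (∀ x, C x x = 0) ↔ (∀ x, ρ x = 0 → B x x = 0) :=
      ⟨fun h x hx => by simpa [hC] using h ⟨x, hx⟩, fun h x => by rw [hC]; exact h x x.2⟩
    have e2 : (∀ x, C' x x = 0) ↔ (∀ x, ρ' x = 0 → B' x x = 0) :=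
      ⟨fun h x hx => by simpa [hC'] using h ⟨x, hx⟩, fun h x => by rw [hC']; exact h x x.2⟩
    have e3 : (∀ x y, C x y = 0) ↔ (∀ x, ρ x = 0 → ∀ y, ρ y = 0 → B x y = 0) :=
      ⟨fun h x hx y hy => by simpa [hC] using h ⟨x, hx⟩ ⟨y, hy⟩, fun h x y => by rw [hC]; exact h x x.2 y y.2⟩
    have e4 : (∀ x y, C' x y = 0) ↔ (∀ x, ρ' x = 0 → ∀ y, ρ' y = 0 → B' x y = 0) :=
      ⟨fun h x hx y hy => by simpa [hC'] using h ⟨x, hx⟩ ⟨y, hy⟩, fun h x y => by rw [hC']; exact h x x.2 y y.2⟩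
    rw [← e1, ← e2, ← e3, ← e4] at ha
    by_cases hz1 : ∀ x y, C x y = 0
    · have hz2 := hz.1 hz1
      exact ⟨fun _ x => hz2 x x, fun _ x => hz1 x x⟩
    · have hz2 := fun h => hz1 (hz.2 h)
      tauto
  obtain ⟨φ, hφ⟩ := IH _ _ C C' (fun x y => by rw [hC, hC, hs]) (fun x y => by rw [hC', hC', hs'])
    (by omega) (by omega) (by omega) ha1
  refine ⟨e ≪≫ₗ ((LinearEquiv.refl _ K).prodCongr φ) ≪≫ₗ e'.symm, ?_⟩
  intro x y
  obtain ⟨a, rfl⟩ := e.symm.surjective x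
  obtain ⟨b, rfl⟩ := e.symm.surjective y
  simp [hCe, hCe', hφ]

theorem z2 (a : ZMod 2) (h : a ≠ 0) : a = 1 := by revert a; decide

theorem z2' (a : ZMod 2) : a + a = 0 := by revert a; decide

theorem goodVec {V : Type} [AddCommGroup V] [Module (ZMod 2) V]
    (B : V →ₗ[ZMod 2] V →ₗ[ZMod 2] ZMod 2) (hs : ∀ x y, B x y = B y x)
    (h : ¬ ∀ x, B x x = 0) : ∃ e, B e e = 1 ∧ 
      ¬ ((∀ x, B e x = 0 → B x x = 0) ∧ ¬ (∀ x, B e x = 0 → ∀ y, B e y = 0 → B x y = 0)) := by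
  push Not at h
  obtain ⟨e, he⟩ := h
  replace he := z2 _ he
  by_cases hc : ((∀ x, B e x = 0 → B x x = 0) ∧ ¬ (∀ x, B e x = 0 → ∀ y, B e y = 0 → B x y = 0))
  · obtain ⟨h1, h2⟩ := hc
    push Not at h2
    obtain ⟨x, hx, y, hy, hxy⟩ := h2
    replace hxy := z2 _ hxy
    refine ⟨e + x, ?_, ?_⟩
    · simp [he, hx, hs x e, h1 x hx]
    · rintro ⟨h3, -⟩
      have := h3 (e + y) (by simp [he, hx, hs x e, hy, hxy, z2'])
      simp [he, hy, hs y e, h1 y hy] at this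
  · exact ⟨e, he, hc⟩

theorem classify (n : ℕ) : ∀ (V V' : Type) [AddCommGroup V] [Module (ZMod 2) V] [AddCommGroup V'] [Module (ZMod 2) V']
      [FiniteDimensional (ZMod 2) V] [FiniteDimensional (ZMod 2) V']
      (B : V →ₗ[ZMod 2] V →ₗ[ZMod 2] ZMod 2) (B' : V' →ₗ[ZMod 2] V' →ₗ[ZMod 2] ZMod 2),
      (∀ x y, B x y = B y x) → (∀ x y, B' x y = B' y x) →
      Module.finrank (ZMod 2) V < n →
      Module.finrank (ZMod 2) V = Module.finrank (ZMod 2) V' →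
      Module.finrank (ZMod 2) (LinearMap.ker B) = Module.finrank (ZMod 2) (LinearMap.ker B') →
      ((∀ x, B x x = 0) ↔ (∀ x, B' x x = 0)) →
      ∃ φ : V ≃ₗ[ZMod 2] V', ∀ x y, B' (φ x) (φ y) = B x y := by
  induction n with
  | zero => intros; omega
  | succ n ih =>
    intro V V' _ _ _ _ _ _ B B' hs hs' hn hd hk ha
    have IH : ∀ (W W' : Type) [AddCommGroup W] [Module (ZMod 2) W] [AddCommGroup W'] [Module (ZMod 2) W']
      [FiniteDimensional (ZMod 2) W] [FiniteDimensional (ZMod 2) W']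
      (C : W →ₗ[ZMod 2] W →ₗ[ZMod 2] ZMod 2) (C' : W' →ₗ[ZMod 2] W' →ₗ[ZMod 2] ZMod 2),
      (∀ x y, C x y = C y x) → (∀ x y, C' x y = C' y x) →
      Module.finrank (ZMod 2) W < Module.finrank (ZMod 2) V →
      Module.finrank (ZMod 2) W = Module.finrank (ZMod 2) W' →
      Module.finrank (ZMod 2) (LinearMap.ker C) = Module.finrank (ZMod 2) (LinearMap.ker C') →
      ((∀ x, C x x = 0) ↔ (∀ x, C' x x = 0)) →
      ∃ φ : W ≃ₗ[ZMod 2] W', ∀ x y, C' (φ x) (φ y) = C x y := by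
      intro W W' _ _ _ _ _ _ C C' a b c d e f
      exact ih W W' C C' a b (by omega) d e f
    by_cases hz : B = 0
    · have : LinearMap.ker B' = ⊤ := by
        apply Submodule.eq_top_of_finrank_eq
        rw [← hk, ← hd, hz, LinearMap.ker_zero, finrank_top]
      rw [LinearMap.ker_eq_top] at this
      exact ⟨LinearEquiv.ofFinrankEq _ _ hd, by simp [hz, this]⟩
    have hz' : B' ≠ 0 := by
      intro h
      apply hz
      rw [← LinearMap.ker_eq_top]
      apply Submodule.eq_top_of_finrank_eq
      rw [hk, hd, h, LinearMap.ker_zero, finrank_top]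
    by_cases halt : ∀ x, B x x = 0
    · have halt' := ha.1 halt
      have ex : ∀ {V : Type} [AddCommGroup V] [Module (ZMod 2) V] 
          (B : V →ₗ[ZMod 2] V →ₗ[ZMod 2] ZMod 2), B ≠ 0 → ∃ e f, B e f = 1 := by
        intro V _ _ B hB
        by_contra! hc
        apply hB
        ext x y
        by_contra h
        exact hc x y (z2 _ h)
      obtain ⟨e, f, hef⟩ := ex B hz
      obtain ⟨e', f', hef'⟩ := ex B' hz'
      refine peelStep (K := ZMod 2 × ZMod 2) B B' hs hs' hd hk (by simp) IH
        ((LinearMap.toSpanSingleton _ _ e).coprod (LinearMap.toSpanSingleton _ _ f))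
        ((B f).prod (B e))
        ((LinearMap.toSpanSingleton _ _ e').coprod (LinearMap.toSpanSingleton _ _ f'))
        ((B' f').prod (B' e')) (fun k l => k.1 * l.2 + k.2 * l.1) ?_ ?_ ?_ ?_ ?_ ?_ ?_ ?_
      · simp
      · rintro ⟨a, b⟩; simp [halt, hs f e, hef]
      · rintro ⟨a, b⟩; simp [halt', hs' f' e', hef']
      · rintro ⟨a, b⟩ v; simp
      · rintro ⟨a, b⟩ v; simp
      · intro v hv; simp [hs _ v, hv]
      · intro v hv; simp [hs' _ v, hv]
      · intro _ _
        exact ⟨fun _ x _ => halt' x, fun _ x _ => halt x⟩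
    · obtain ⟨e, he, hg⟩ := goodVec B hs halt
      obtain ⟨e', he', hg'⟩ := goodVec B' hs' (fun h => halt (ha.2 h))
      refine peelStep (K := ZMod 2) B B' hs hs' hd hk (by simp) IH
        (LinearMap.toSpanSingleton _ _ e) (B e) 
        (LinearMap.toSpanSingleton _ _ e') (B' e') (fun k l => k * l) ?_ ?_ ?_ ?_ ?_ ?_ ?_ ?_
      · simp
      · simp [he]
      · simp [he']
      · simp
      · simp
      · intro v hv; simp [hs _ v, hv]
      · intro v hv; simp [hs' _ v, hv]
      · tauto

open Matrix

def c42 : ZMod 4 →+* ZMod 2 := ZMod.castHom (by decide : 2 ∣ 4) (ZMod 2)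

theorem c42_two (a b : ZMod 4) : 2 * a = 2 * b ↔ c42 a = c42 b := by
  revert a b; decide

theorem c42_surj (a : ZMod 2) : ∃ b, c42 b = a := by
  revert a; decide

def Good4 {ι : Type} [Fintype ι] [DecidableEq ι] (M : Matrix ι ι (ZMod 4)) : Prop :=
  ∃ P : Matrix ι ι ℤ, (P.det = 1 ∨ P.det = -1) ∧ P.map (Int.castRingHom (ZMod 4)) = M

section
variable {ι : Type} [Fintype ι] [DecidableEq ι]

theorem good_one : Good4 (1 : Matrix ι ι (ZMod 4)) := ⟨1, by simp, by simp⟩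

theorem good_mul {M N : Matrix ι ι (ZMod 4)} (hM : Good4 M) (hN : Good4 N) : Good4 (M * N) := by
  obtain ⟨P, hP, rfl⟩ := hM
  obtain ⟨Q, hQ, rfl⟩ := hN
  refine ⟨P * Q, ?_, by rw [Matrix.map_mul]⟩
  rw [det_mul]
  rcases hP with h | h <;> rcases hQ with h' | h' <;> simp [h, h']

theorem good_det {M : Matrix ι ι (ZMod 4)} (hM : Good4 M) : IsUnit M.det := by
  obtain ⟨P, hP, rfl⟩ := hM
  have : (P.map (Int.castRingHom (ZMod 4))).det = Int.castRingHom (ZMod 4) P.det := by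
    rw [RingHom.map_det]; rfl
  rw [this]
  rcases hP with h | h <;> simp [h]

theorem good_two (X : Matrix ι ι (ZMod 4)) : Good4 (1 + 2 • X) := by
  induction X using Matrix.induction_on' with
  | h_zero => simpa using good_one
  | h_add p q hp hq =>
    have := good_mul hp hq
    convert this using 1
    have h4 : (4 : ℕ) • (p * q) = 0 := by
      rw [← Nat.cast_smul_eq_nsmul (ZMod 4)]
      have : ((4 : ℕ) : ZMod 4) = 0 := by decide
      rw [this, zero_smul]
    rw [mul_add, add_mul, add_mul, one_mul, mul_one, one_mul, smul_mul_smul_comm]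
    norm_num [h4]
    abel
  | h_std_basis i j x =>
    by_cases hij : i = j
    · subst hij
      by_cases hx : 2 * x = 0
      · have h0 : (1 : Matrix ι ι (ZMod 4)) + 2 • single i i x = 1 := by
          rw [smul_single, nsmul_eq_mul]
          simp [hx]
        rw [h0]
        exact good_one
      · have hx2 : 2 * x = -2 := by revert x; decide
        refine ⟨diagonal (Function.update 1 i (-1)), ?_, ?_⟩
        · right
          rw [det_diagonal, Finset.prod_update_of_mem (Finset.mem_univ i)]
          simp
        · rw [smul_single, nsmul_eq_mul]
          norm_num [hx2]
          ext a b
          by_cases hab : a = b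
          · subst hab
            by_cases hai : a = i
            · subst hai; simp; decide
            · simp [hai, Matrix.single, Ne.symm hai]
          · simp [hab, Matrix.single]
            intro h h'
            exact absurd (h.symm.trans h') hab
    · refine ⟨transvection i j (2 * x.val : ℤ), ?_, ?_⟩
      · left; exact det_transvection_of_ne i j hij _
      · rw [transvection, Matrix.map_add _ (map_add _), smul_single, nsmul_eq_mul]
        ext a b
        simp [Matrix.single, Matrix.one_apply]

theorem good_lift (T : Matrix ι ι (ZMod 2)) (hT : T.det ≠ 0) :
    ∃ M : Matrix ι ι (ZMod 4), Good4 M ∧ M.map c42 = T := by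
  refine Matrix.diagonal_transvection_induction_of_det_ne_zero
    (fun T => ∃ M : Matrix ι ι (ZMod 4), Good4 M ∧ M.map c42 = T) T hT ?_ ?_ ?_
  · intro D hD
    refine ⟨1, good_one, ?_⟩
    rw [det_diagonal, Finset.prod_ne_zero_iff] at hD
    have : D = fun _ => 1 := by
      funext i
      have h := hD i (Finset.mem_univ i)
      have : ∀ a : ZMod 2, a ≠ 0 → a = 1 := by decide
      exact this _ h
    rw [this]
    ext a b
    simp [Matrix.one_apply, diagonal_apply]
  · intro t
    refine ⟨transvection t.i t.j (t.c.val : ZMod 4), ⟨transvection t.i t.j (t.c.val : ℤ), ?_, ?_⟩, ?_⟩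
    · left; exact det_transvection_of_ne _ _ t.hij _
    · ext a b
      simp [transvection, Matrix.single, Matrix.one_apply]
    · ext a b
      simp [transvection, Matrix.single, Matrix.one_apply, TransvectionStruct.toMatrix]
      have hc : ∀ a : ZMod 2, c42 (a.cast : ZMod 4) = a := by decide
      split_ifs <;> simp [hc]
  · rintro A B _ _ ⟨M, hM, rfl⟩ ⟨N, hN, rfl⟩
    exact ⟨M * N, good_mul hM hN, by rw [Matrix.map_mul]⟩

theorem good_blocks {α β : Type} [Fintype α] [DecidableEq α] [Fintype β] [DecidableEq β]
    {G : Matrix β β (ZMod 4)} (hG : Good4 G) :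
    Good4 (fromBlocks (1 : Matrix α α (ZMod 4)) 0 0 G) := by
  obtain ⟨P, hP, rfl⟩ := hG
  refine ⟨fromBlocks 1 0 0 P, ?_, ?_⟩
  · simpa using hP
  · rw [fromBlocks_map]; simp

theorem good_reindex {κ : Type} [Fintype κ] [DecidableEq κ] (e : κ ≃ ι)
    {G : Matrix ι ι (ZMod 4)} (hG : Good4 G) : Good4 (G.submatrix e e) := by
  obtain ⟨P, hP, rfl⟩ := hG
  exact ⟨P.submatrix e e, by rwa [det_submatrix_equiv_self], by rw [submatrix_map]⟩

/-- reductions of kernel vectors -/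
def WW (M : Matrix ι ι (ZMod 4)) : Set (ι → ZMod 2) :=
  {x | ∃ y : ι → ZMod 4, M *ᵥ y = 0 ∧ ∀ i, c42 (y i) = x i}

theorem c42_mulVec (P : Matrix ι ι (ZMod 4)) (y : ι → ZMod 4) (i : ι) :
    c42 ((P *ᵥ y) i) = ((P.map c42) *ᵥ (fun j => c42 (y j))) i := by
  simp [mulVec, dotProduct]

theorem WW_congr (M P : Matrix ι ι (ZMod 4)) (hP : IsUnit P.det) :
    Nat.card (WW (Pᵀ * M * P)) = Nat.card (WW M) := by
  have hu : IsUnit P := (Matrix.isUnit_iff_isUnit_det P).2 hP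
  obtain ⟨u, rfl⟩ := hu
  set P : Matrix ι ι (ZMod 4) := (u : Matrix ι ι (ZMod 4)) with hPdef
  set Q : Matrix ι ι (ZMod 4) := ((u⁻¹ : (Matrix ι ι (ZMod 4))ˣ) : Matrix ι ι (ZMod 4)) with hQdef
  have h1 : P * Q = 1 := by simp [P, Q]
  have h2 : Q * P = 1 := by simp [P, Q]
  have h3 : Qᵀ * Pᵀ = 1 := by rw [← transpose_mul, h1, transpose_one]
  have m1 : P.map c42 * Q.map c42 = 1 := by
    rw [← Matrix.map_mul, h1]; simp
  have m2 : Q.map c42 * P.map c42 = 1 := by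
    rw [← Matrix.map_mul, h2]; simp
  have step : ∀ x, x ∈ WW (Pᵀ * M * P) → P.map c42 *ᵥ x ∈ WW M := by
    rintro x ⟨y, hy, hx⟩
    refine ⟨P *ᵥ y, ?_, ?_⟩
    · have : Qᵀ *ᵥ ((Pᵀ * M * P) *ᵥ y) = 0 := by rw [hy, mulVec_zero]
      rw [mulVec_mulVec, mul_assoc Pᵀ, ← mul_assoc, h3, one_mul] at this
      rw [mulVec_mulVec, this]
    · intro i
      rw [c42_mulVec]
      congr 1
      funext j; exact hx j
  have step2 : ∀ x, x ∈ WW M → Q.map c42 *ᵥ x ∈ WW (Pᵀ * M * P) := by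
    rintro x ⟨y, hy, hx⟩
    refine ⟨Q *ᵥ y, ?_, ?_⟩
    · rw [mulVec_mulVec, mul_assoc, h1, mul_one, ← mulVec_mulVec, hy, mulVec_zero]
    · intro i
      rw [c42_mulVec]
      congr 1
      funext j; exact hx j
  exact Nat.card_congr
    { toFun := fun x => ⟨_, step x.1 x.2⟩
      invFun := fun x => ⟨_, step2 x.1 x.2⟩
      left_inv := fun x => by ext1; simp [mulVec_mulVec, m2]
      right_inv := fun x => by ext1; simp [mulVec_mulVec, m1] }

noncomputable def bf2 {β : Type} [Fintype β] [DecidableEq β] (S : Matrix β β (ZMod 2)) :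
    (β → ZMod 2) →ₗ[ZMod 2] (β → ZMod 2) →ₗ[ZMod 2] ZMod 2 :=
  Matrix.toLinearMap₂' (ZMod 2) S

theorem classMat {β : Type} [Fintype β] [DecidableEq β] (S D : Matrix β β (ZMod 2))
    (hS : S.IsSymm) (hD : D.IsSymm)
    (hc : Nat.card {x // S *ᵥ x = 0} = Nat.card {x // D *ᵥ x = 0})
    (ha : ∀ x, x ⬝ᵥ S *ᵥ x = x ⬝ᵥ D *ᵥ x) :
    ∃ G : Matrix β β (ZMod 2), G.det ≠ 0 ∧ Gᵀ * S * G = D := by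
  have ap : ∀ (S : Matrix β β (ZMod 2)) x y, bf2 S x y = x ⬝ᵥ S *ᵥ y :=
    fun S x y => by rw [bf2, Matrix.toLinearMap₂'_apply']
  have sy : ∀ (S : Matrix β β (ZMod 2)), S.IsSymm → ∀ x y,
      bf2 S x y = bf2 S y x := by
    intro S hS x y
    rw [ap, ap, dotProduct_comm, ← vecMul_transpose, hS.eq, ← dotProduct_mulVec]
  have kr : ∀ (S : Matrix β β (ZMod 2)), S.IsSymm →
      Nat.card {x // S *ᵥ x = 0} = 2 ^ Module.finrank (ZMod 2)
        (LinearMap.ker (bf2 S)) := by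
    intro S hS
    have h := Module.natCard_eq_pow_finrank (K := ZMod 2) (V := (LinearMap.ker (bf2 S)))
    rw [Nat.card_zmod] at h
    rw [← h]
    apply Nat.card_congr
    apply Equiv.subtypeEquivRight
    intro x
    rw [LinearMap.mem_ker]
    constructor
    · intro hx
      apply LinearMap.ext
      intro y
      rw [sy S hS, ap, hx]; simp
    · intro hx
      funext i
      have := LinearMap.congr_fun hx (Pi.single i 1)
      rw [sy S hS, ap] at this
      simpa using this
  rw [kr S hS, kr D hD] at hc
  have hc' := (Nat.pow_right_injective (le_refl 2) hc).symm
  obtain ⟨φ, hφ⟩ := classify _ (β → ZMod 2) (β → ZMod 2) (bf2 D)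
    (bf2 S) (sy D hD) (sy S hS) (Nat.lt_succ_self _) rfl hc' (by
      simp only [ap, ha])
  refine ⟨LinearMap.toMatrix' (φ : (β → ZMod 2) →ₗ[ZMod 2] (β → ZMod 2)), ?_, ?_⟩
  · rw [LinearMap.det_toMatrix']
    exact (LinearEquiv.isUnit_det' φ).ne_zero
  · have e : ∀ x, LinearMap.toMatrix' (φ : (β → ZMod 2) →ₗ[ZMod 2] (β → ZMod 2)) *ᵥ x = φ x := by
      intro x; rw [LinearMap.toMatrix'_mulVec]; rfl
    ext i j
    have := hφ (Pi.single i 1) (Pi.single j 1)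
    rw [ap, ap, ← e, ← e] at this
    rw [← vecMul_transpose, ← dotProduct_mulVec, mulVec_mulVec, mulVec_mulVec] at this
    simpa [mul_assoc] using this

end

section
variable {α β : Type} [Fintype α] [DecidableEq α] [Fintype β] [DecidableEq β]

theorem four_nsmul {κ τ : Type} (X : Matrix κ τ (ZMod 4)) : (4 : ℕ) • X = 0 := by
  rw [← Nat.cast_smul_eq_nsmul (ZMod 4)]
  have : ((4 : ℕ) : ZMod 4) = 0 := by decide
  rw [this, zero_smul]

theorem two_nsmul_eq {κ τ : Type} (X Y : Matrix κ τ (ZMod 4)) (h : X.map c42 = Y.map c42) :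
    (2 : ℕ) • X = (2 : ℕ) • Y := by
  ext i j
  have := congrFun (congrFun h i) j
  simp only [map_apply] at this
  simpa using (c42_two _ _).2 this

theorem core1 (H : Matrix α α (ZMod 4)) (D : Matrix β β (ZMod 4)) (hHs : Hᵀ = H) (σ : α → α)
    (hσ : ∀ i, σ (σ i) = i) (hH : ∀ i j, 2 * H i j = if j = σ i then 2 else 0)
    (F : Matrix (α ⊕ β) (α ⊕ β) (ZMod 4)) :
    ∃ Q, Good4 Q ∧ Qᵀ * (fromBlocks H 0 0 (2 • D) + 2 • (F + Fᵀ)) * Q =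
      fromBlocks H 0 0 (2 • (D + (F.toBlocks₂₂ + F.toBlocks₂₂ᵀ))) := by
  have hHX : ∀ {τ : Type} (Y : Matrix α τ (ZMod 4)), 2 • (H * Y.submatrix σ id) = 2 • Y := by
    intro τ Y
    ext i k
    simp only [Matrix.smul_apply, nsmul_eq_mul, mul_apply, submatrix_apply, id, Nat.cast_ofNat]
    rw [Finset.mul_sum]
    simp only [← mul_assoc, hH]
    simp [hσ]
  obtain ⟨F11, F12, F21, F22, rfl⟩ : ∃ a b c d, F = fromBlocks a b c d :=
    ⟨_, _, _, _, (fromBlocks_toBlocks F).symm⟩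
  set X1 := F11.submatrix σ id with hX1
  set X2 := (F12 + F21ᵀ).submatrix σ id with hX2
  have e1 : 2 • (H * X1) = 2 • F11 := hHX _
  have e2 : 2 • (H * X2) = 2 • (F12 + F21ᵀ) := hHX _
  refine ⟨1 + 2 • fromBlocks X1 X2 0 0, good_two _, ?_⟩
  have gen : ∀ (A E X : Matrix (α ⊕ β) (α ⊕ β) (ZMod 4)), 
      (1 + 2 • X)ᵀ * (A + 2 • E) * (1 + 2 • X) = A + 2 • E + 2 • (Xᵀ * A) + 2 • (A * X) := by
    intro A E X
    have : (1 + 2 • X)ᵀ * (A + 2 • E) * (1 + 2 • X) = A + 2 • E + 2 • (Xᵀ * A) + 2 • (A * X) + 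
       4 • (Xᵀ * E + E * X + Xᵀ * A * X + 2 • (Xᵀ * E * X)) := by
      rw [transpose_add, transpose_one, transpose_smul]
      noncomm_ring
    rw [this, four_nsmul, add_zero]
  rw [gen]
  have e1' : 2 • (X1ᵀ * H) = 2 • F11ᵀ := by
    have := congrArg transpose e1
    rwa [transpose_smul, transpose_mul, hHs, transpose_smul] at this
  have e2' : 2 • (X2ᵀ * H) = 2 • (F12ᵀ + F21) := by
    have := congrArg transpose e2
    rwa [transpose_smul, transpose_mul, hHs, transpose_smul, transpose_add, transpose_transpose] at this
  have d : ∀ {κ τ : Type} (X : Matrix κ τ (ZMod 4)), 2 • X + 2 • X = 0 := by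
    intro κ τ X
    rw [← four_nsmul X, ← add_smul]
  simp only [fromBlocks_transpose, fromBlocks_multiply, fromBlocks_smul, fromBlocks_add, toBlocks_fromBlocks₂₂]
  simp only [transpose_zero, Matrix.zero_mul, Matrix.mul_zero, add_zero, zero_add, e1, e2, e1', e2', smul_zero]
  congr 1
  · rw [add_assoc, add_comm (2 • F11ᵀ), ← smul_add, add_assoc, d, add_zero]
  · exact d _
  · rw [add_comm F21]; exact d _
  · simp

theorem WW_blocks (H : Matrix α α (ZMod 4)) (S : Matrix β β (ZMod 4)) (σ : α → α)
    (hσ : ∀ i, σ (σ i) = i) (hH : ∀ i j, 2 * H i j = if j = σ i then 2 else 0) :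
    Nat.card (WW (fromBlocks H 0 0 (2 • S))) = Nat.card {x // S.map c42 *ᵥ x = 0} := by
  have hS : ∀ (y : β → ZMod 4), (2 • S) *ᵥ y = 0 ↔ S.map c42 *ᵥ (fun j => c42 (y j)) = 0 := by
    intro y
    rw [funext_iff, funext_iff]
    refine forall_congr' fun i => ?_
    rw [← c42_mulVec, smul_mulVec]
    have := c42_two ((S *ᵥ y) i) 0
    simpa using this
  have hmem : ∀ x, x ∈ WW (fromBlocks H 0 0 (2 • S)) ↔ (∀ i, x (Sum.inl i) = 0) ∧
      S.map c42 *ᵥ (fun j => x (Sum.inr j)) = 0 := by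
    intro x
    constructor
    · rintro ⟨y, hy, hx⟩
      obtain ⟨y1, y2, rfl⟩ : ∃ a b, y = Sum.elim a b := ⟨_, _, (Sum.elim_comp_inl_inr y).symm⟩
      rw [fromBlocks_mulVec] at hy
      simp only [Sum.elim_comp_inl, Sum.elim_comp_inr, zero_mulVec, add_zero, zero_add] at hy
      have hy1 : H *ᵥ y1 = 0 := by funext i; exact congrFun hy (Sum.inl i)
      have hy2 : (2 • S) *ᵥ y2 = 0 := by funext i; exact congrFun hy (Sum.inr i)
      constructor
      · intro i
        rw [← hx, Sum.elim_inl, ← map_zero c42, ← c42_two, mul_zero]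
        have h := congrFun hy1 (σ i)
        have : 2 * (H *ᵥ y1) (σ i) = 0 := by rw [h]; simp
        simp only [mulVec, dotProduct] at this
        rw [Finset.mul_sum] at this
        simp only [← mul_assoc, hH] at this
        simpa [hσ] using this
      · rw [hS] at hy2
        rw [← hy2]
        congr 1
        funext j
        rw [← hx]; rfl
    · rintro ⟨h1, h2⟩
      choose g hg using c42_surj
      refine ⟨Sum.elim 0 (fun j => g (x (Sum.inr j))), ?_, ?_⟩
      · rw [fromBlocks_mulVec]
        simp only [Sum.elim_comp_inl, Sum.elim_comp_inr, zero_mulVec, add_zero, zero_add, mulVec_zero]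
        rw [(hS _).2]
        · ext i; cases i <;> rfl
        · simpa [hg] using h2
      · rintro (i | j)
        · simp [h1]
        · simp [hg]
  refine Nat.card_congr
    { toFun := fun x => ⟨fun j => x.1 (Sum.inr j), ((hmem _).1 x.2).2⟩
      invFun := fun x => ⟨Sum.elim 0 x.1, (hmem _).2 ⟨fun i => rfl, x.2⟩⟩
      left_inv := ?_
      right_inv := ?_ }
  · rintro ⟨x, hx⟩
    ext i
    rcases i with i | j
    · exact (((hmem _).1 hx).1 i).symm
    · rfl
  · rintro ⟨x, hx⟩
    rfl

theorem core2 (H : Matrix α α (ZMod 4)) (D : Matrix β β (ZMod 4)) (hHs : Hᵀ = H) (hDs : Dᵀ = D) (σ : α → α)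
    (hσ : ∀ i, σ (σ i) = i) (hH : ∀ i j, 2 * H i j = if j = σ i then 2 else 0)
    (F : Matrix (α ⊕ β) (α ⊕ β) (ZMod 4))
    (hW : Nat.card (WW (fromBlocks H 0 0 (2 • D) + 2 • (F + Fᵀ))) =
      Nat.card (WW (fromBlocks H 0 0 (2 • D)))) :
    ∃ Q, Good4 Q ∧ Qᵀ * (fromBlocks H 0 0 (2 • D) + 2 • (F + Fᵀ)) * Q =
      fromBlocks H 0 0 (2 • D) := by
  obtain ⟨Q, hQ, hQe⟩ := core1 H D hHs σ hσ hH F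
  rw [← WW_congr _ Q (good_det hQ), hQe, WW_blocks H _ σ hσ hH, WW_blocks H _ σ hσ hH] at hW
  set F2 := F.toBlocks₂₂
  obtain ⟨G, hG, hGe⟩ := classMat ((D + (F2 + F2ᵀ)).map c42) (D.map c42) (by
    rw [Matrix.IsSymm, ← transpose_map]
    congr 1
    simp [hDs]
    abel) (by rw [Matrix.IsSymm, ← transpose_map, hDs]) hW (by
    intro x
    rw [Matrix.map_add _ (map_add _), Matrix.map_add _ (map_add _), add_mulVec, add_mulVec,
      dotProduct_add, dotProduct_add, transpose_map, mulVec_transpose, dotProduct_comm x (x ᵥ* _),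
      ← dotProduct_mulVec, z2', add_zero])
  obtain ⟨G4, hG4, rfl⟩ := good_lift G hG
  refine ⟨Q * fromBlocks 1 0 0 G4, good_mul hQ (good_blocks hG4), ?_⟩
  have : (Q * fromBlocks 1 0 0 G4)ᵀ * (fromBlocks H 0 0 (2 • D) + 2 • (F + Fᵀ)) * (Q * fromBlocks 1 0 0 G4) =
     (fromBlocks 1 0 0 G4)ᵀ * (Qᵀ * (fromBlocks H 0 0 (2 • D) + 2 • (F + Fᵀ)) * Q) * fromBlocks 1 0 0 G4 := by
    rw [transpose_mul]; simp only [mul_assoc]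
  rw [this, hQe, fromBlocks_transpose, fromBlocks_multiply, fromBlocks_multiply]
  simp only [transpose_zero, transpose_one, Matrix.zero_mul, Matrix.mul_zero, add_zero, zero_add, one_mul, mul_one,
    mul_smul_comm, smul_mul_assoc]
  rw [two_nsmul_eq (G4ᵀ * (D + (F2 + F2ᵀ)) * G4) D]
  rw [Matrix.map_mul, Matrix.map_mul, ← hGe, transpose_map]

end

theorem core3 {ι α β : Type} [Fintype ι] [DecidableEq ι] [Fintype α] [DecidableEq α] [Fintype β] [DecidableEq β]
    (e : α ⊕ β ≃ ι) (M : Matrix ι ι (ZMod 4))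
    (H : Matrix α α (ZMod 4)) (D : Matrix β β (ZMod 4)) (hHs : Hᵀ = H) (hDs : Dᵀ = D) (σ : α → α)
    (hσ : ∀ i, σ (σ i) = i) (hH : ∀ i j, 2 * H i j = if j = σ i then 2 else 0)
    (hM : M.submatrix e e = fromBlocks H 0 0 (2 • D))
    (F : Matrix ι ι (ZMod 4))
    (hW : Nat.card (WW (M + 2 • (F + Fᵀ))) = Nat.card (WW M)) :
    ∃ Q, Good4 Q ∧ Qᵀ * (M + 2 • (F + Fᵀ)) * Q = M := by
  have hre : ∀ N : Matrix ι ι (ZMod 4), Nat.card (WW (N.submatrix e e)) = Nat.card (WW N) := by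
    intro N
    refine Nat.card_congr
      { toFun := fun x => ⟨fun i => x.1 (e.symm i), ?_⟩
        invFun := fun x => ⟨fun i => x.1 (e i), ?_⟩
        left_inv := fun x => by ext1; simp
        right_inv := fun x => by ext1; simp }
    · obtain ⟨x, y, hy, hx⟩ := x
      refine ⟨fun i => y (e.symm i), ?_, fun i => hx _⟩
      rw [submatrix_mulVec_equiv] at hy
      funext i
      have := congrFun hy (e.symm i)
      simp only [Function.comp_apply, Equiv.apply_symm_apply, Pi.zero_apply] at this
      exact this
    · obtain ⟨x, y, hy, hx⟩ := x
      refine ⟨fun i => y (e i), ?_, fun i => hx _⟩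
      rw [submatrix_mulVec_equiv]
      have : (fun i => y (e i)) ∘ e.symm = y := by funext i; simp
      rw [this, hy]; rfl
  have hB : (M + 2 • (F + Fᵀ)).submatrix e e =
      fromBlocks H 0 0 (2 • D) + 2 • (F.submatrix e e + (F.submatrix e e)ᵀ) := by
    rw [← hM]; rfl
  obtain ⟨Q, hQ, hQe⟩ := core2 H D hHs hDs σ hσ hH (F.submatrix e e) (by
    rw [← hB, ← hM, hre, hre, hW])
  refine ⟨Q.submatrix e.symm e.symm, good_reindex e.symm hQ, ?_⟩
  rw [← hB, ← hM] at hQe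
  have := congrArg (fun X => X.submatrix e.symm e.symm) hQe
  rw [← submatrix_mul_equiv _ _ _ e.symm, ← submatrix_mul_equiv _ _ _ e.symm] at this
  simpa using this

theorem half4 : ∀ a : ZMod 4, 2 * a = 0 → ∃ b, a = 2 * b := by decide

theorem val_lift {n : ℕ} (M : Matrix (Fin n) (Fin n) (ZMod 4)) (hM : Mᵀ = M) (y z : Fin n → ZMod 4)
    (h : ∀ i, c42 (y i) = c42 (z i)) : y ⬝ᵥ M *ᵥ y = z ⬝ᵥ M *ᵥ z := by
  have h2 : ∀ i, ∃ b, y i - z i = 2 * b := fun i => half4 _ (by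
    have := (c42_two _ _).2 (h i)
    rw [mul_sub, this, sub_self])
  choose w hw using h2
  have hy : y = z + (2 : ZMod 4) • w := by
    funext i
    simp only [Pi.add_apply, Pi.smul_apply, smul_eq_mul, ← hw]
    ring
  have hs : w ⬝ᵥ M *ᵥ z = z ⬝ᵥ M *ᵥ w := by
    rw [dotProduct_comm, ← vecMul_transpose, hM, ← dotProduct_mulVec]
  rw [hy]
  simp only [mulVec_add, mulVec_smul, add_dotProduct, dotProduct_add, smul_dotProduct, dotProduct_smul, hs, smul_eq_mul]
  have h4 : (4 : ZMod 4) = 0 := by decide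
  linear_combination (z ⬝ᵥ M *ᵥ w + w ⬝ᵥ M *ᵥ w) * h4

theorem even_val {n : ℕ} (M : Matrix (Fin n) (Fin n) (ZMod 4)) (hM : Mᵀ = M) (hd : ∀ i, 2 * M i i = 0)
    (y : Fin n → ZMod 4) : 2 * (y ⬝ᵥ M *ᵥ y) = 0 := by
  choose g hg using fun i => half4 _ (hd i)
  let F : Matrix (Fin n) (Fin n) (ZMod 4) := Matrix.of fun i j => if i < j then M i j else if i = j then g i else 0
  have hF : M = F + Fᵀ := by
    ext i j
    simp only [Matrix.add_apply, transpose_apply, F, of_apply]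
    rcases lt_trichotomy i j with h | h | h
    · simp [h, h.not_gt, h.ne']
    · subst h; simp [hg]; ring
    · have := congrFun (congrFun hM i) j
      simp only [transpose_apply] at this
      simp [h, h.not_gt, h.ne', this]
  have h4 : (4 : ZMod 4) = 0 := by decide
  have hs : y ⬝ᵥ Fᵀ *ᵥ y = y ⬝ᵥ F *ᵥ y := by
    rw [mulVec_transpose, dotProduct_comm, ← dotProduct_mulVec]
  rw [hF, add_mulVec, dotProduct_add, hs]
  linear_combination (y ⬝ᵥ F *ᵥ y) * h4

theorem qf_spec {n : ℕ} (A : Matrix (Fin n) (Fin n) ℤ) (M : Matrix (Fin n) (Fin n) (ZMod 4))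
    (hA : ∀ i j, ((A i j : ℤ) : ZMod 4) = M i j)
    (hM : Mᵀ = M) (hd : ∀ i, 2 * M i i = 0) (v : Fin n → ZMod 2) (y : Fin n → ZMod 4)
    (hy : ∀ i, c42 (y i) = v i) :
    ∃ N : ℤ, 2 ∣ N ∧ (N : ZMod 4) = y ⬝ᵥ M *ᵥ y ∧ qf A v = ((N / 2 : ℤ) : ZMod 2) := by
  refine ⟨((fun i => ((v i).val : ℤ)) ⬝ᵥ A.mulVec (fun i => ((v i).val : ℤ))), ?_, ?_, rfl⟩
  all_goals
    have hN : ((((fun i => ((v i).val : ℤ)) ⬝ᵥ A.mulVec (fun i => ((v i).val : ℤ)) : ℤ)) : ZMod 4) =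
      y ⬝ᵥ M *ᵥ y := by
      rw [val_lift M hM y (fun i => ((v i).val : ZMod 4))]
      · simp [dotProduct, mulVec, hA]
      · intro i
        rw [hy]
        generalize v i = a
        revert a; decide
  · have := even_val M hM hd y
    rw [← hN] at this
    generalize ((fun i => ((v i).val : ℤ)) ⬝ᵥ A.mulVec (fun i => ((v i).val : ℤ)) : ℤ) = N at this
    have h2 : ((2 * N : ℤ) : ZMod 4) = 0 := by push_cast; exact this
    rw [ZMod.intCast_zmod_eq_zero_iff_dvd] at h2
    push_cast at h2
    omega
  · exact hN

theorem qf_eq_iff {n : ℕ} (A A' : Matrix (Fin n) (Fin n) ℤ) (M M' : Matrix (Fin n) (Fin n) (ZMod 4))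
    (hA : ∀ i j, ((A i j : ℤ) : ZMod 4) = M i j) (hA' : ∀ i j, ((A' i j : ℤ) : ZMod 4) = M' i j)
    (hM : Mᵀ = M) (hd : ∀ i, 2 * M i i = 0) (hM' : M'ᵀ = M') (hd' : ∀ i, 2 * M' i i = 0)
    (v v' : Fin n → ZMod 2) (y y' : Fin n → ZMod 4)
    (hy : ∀ i, c42 (y i) = v i) (hy' : ∀ i, c42 (y' i) = v' i) :
    qf A v = qf A' v' ↔ y ⬝ᵥ M *ᵥ y = y' ⬝ᵥ M' *ᵥ y' := by
  obtain ⟨N, h1, h2, h3⟩ := qf_spec A M hA hM hd v y hy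
  obtain ⟨N', h1', h2', h3'⟩ := qf_spec A' M' hA' hM' hd' v' y' hy'
  rw [h3, h3', ← h2, ← h2', ZMod.intCast_eq_intCast_iff, ZMod.intCast_eq_intCast_iff, Int.ModEq, Int.ModEq]
  push_cast
  omega

/-- the partner involution -/
def tau (k i : ℕ) : ℕ := if i < 2 * k then (if i % 2 = 0 then i + 1 else i - 1) else i

theorem tau_tau (k i : ℕ) : tau k (tau k i) = i := by
  unfold tau; split_ifs <;> omega

theorem nf_top (r s t p i j : ℕ) (h : i < 2 * r + 2 * s) :
    nfEntry r s t p i j % 2 = if j = tau (r + s) i then 1 else 0 := by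
  unfold nfEntry tau; split_ifs <;> omega

theorem nf_bot (r s t p i j : ℕ) (h : 2 * r + 2 * s ≤ i) (h' : i < 2 * r + 2 * s + 2 * t + p) :
    nfEntry r s t p i j = if j = tau (r + s + t) i then 2 else 0 := by
  unfold nfEntry tau; split_ifs <;> omega

theorem nf_zero (r s t p i j : ℕ) (h : 2 * r + 2 * s + 2 * t + p ≤ i) : nfEntry r s t p i j = 0 := by
  unfold nfEntry; split_ifs <;> omega

theorem nf_symm (r s t p i j : ℕ) : nfEntry r s t p i j = nfEntry r s t p j i := by
  unfold nfEntry; split_ifs <;> omega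

theorem nf_diag (r s t p i : ℕ) : 2 ∣ nfEntry r s t p i i := by
  unfold nfEntry; split_ifs <;> omega

theorem nf_off (r s t p i j : ℕ) (h : i < 2 * r + 2 * s) (h' : ¬ j < 2 * r + 2 * s) : nfEntry r s t p i j = 0 := by
  unfold nfEntry; split_ifs <;> omega

theorem two_cast (a b : ℤ) (h : a % 2 = b % 2) : 2 * (a : ZMod 4) = 2 * (b : ZMod 4) := by
  have : ((2 * a : ℤ) : ZMod 4) = ((2 * b : ℤ) : ZMod 4) := by
    rw [ZMod.intCast_eq_intCast_iff, Int.ModEq]; push_cast; omega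
  push_cast at this; exact this

def nf4 (n r s t p : ℕ) : Matrix (Fin n) (Fin n) (ZMod 4) := fun i j => ((nfEntry r s t p i j : ℤ) : ZMod 4)

theorem nf4_symm (n r s t p : ℕ) : (nf4 n r s t p)ᵀ = nf4 n r s t p := by
  ext i j; simp only [transpose_apply, nf4]; rw [nf_symm]

theorem nf4_diag (n r s t p : ℕ) (i : Fin n) : 2 * nf4 n r s t p i i = 0 := by
  have := two_cast (nfEntry r s t p i i) 0 (by have := nf_diag r s t p i; omega)
  simpa [nf4] using this

theorem nf4_WW (n r s t p m : ℕ) (hn : n = 2*r + 2*s + 2*t + p + m) :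
    Nat.card (WW (nf4 n r s t p)) = 2 ^ m := by
  have hmem : ∀ x, x ∈ WW (nf4 n r s t p) ↔ ∀ i : Fin n, (i : ℕ) < 2*r + 2*s + 2*t + p → x i = 0 := by
    intro x
    constructor
    · rintro ⟨y, hy, hx⟩ i hi
      rw [← hx, ← map_zero c42, ← c42_two, mul_zero]
      by_cases h : (i : ℕ) < 2 * r + 2 * s
      · have hlt : tau (r + s) i < 2 * r + 2 * s := by unfold tau; split_ifs <;> omega
        have h0 := congrFun hy ⟨tau (r + s) i, by omega⟩
        have : 2 * (nf4 n r s t p *ᵥ y) ⟨tau (r + s) i, by omega⟩ = 0 := by rw [h0]; simp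
        simp only [mulVec, dotProduct] at this
        rw [Finset.mul_sum] at this
        rw [← this, Finset.sum_eq_single i]
        · rw [← mul_assoc]; congr 1
          have := two_cast (nfEntry r s t p (tau (r + s) i) i) 1 (by
            rw [nf_top _ _ _ _ _ _ hlt, tau_tau]; simp)
          simpa [nf4] using this.symm
        · intro j _ hj
          have := two_cast (nfEntry r s t p (tau (r + s) i) j) 0 (by
            rw [nf_top _ _ _ _ _ _ hlt, tau_tau, if_neg (fun h => hj (Fin.ext h))]; rfl)
          rw [← mul_assoc]
          simp only [nf4]
          rw [this]; simp
        · simp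
      · have hlt : tau (r + s + t) i < 2 * r + 2 * s + 2 * t + p ∧ 2 * r + 2 * s ≤ tau (r + s + t) i := by
          unfold tau; split_ifs <;> omega
        have h0 := congrFun hy ⟨tau (r + s + t) i, by omega⟩
        simp only [mulVec, dotProduct, Pi.zero_apply] at h0
        rw [← h0, Finset.sum_eq_single i]
        · simp only [nf4]
          rw [nf_bot _ _ _ _ _ _ hlt.2 hlt.1, tau_tau]; simp
        · intro j _ hj
          simp only [nf4]
          rw [nf_bot _ _ _ _ _ _ hlt.2 hlt.1, tau_tau, if_neg (fun h => hj (Fin.ext h))]; simp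
        · simp
    · intro h
      choose g hg using c42_surj
      refine ⟨fun i => if (i : ℕ) < 2*r + 2*s + 2*t + p then 0 else g (x i), ?_, ?_⟩
      · funext i
        simp only [mulVec, dotProduct, Pi.zero_apply]
        apply Finset.sum_eq_zero
        intro j _
        split_ifs with hj
        · simp
        · simp only [nf4]
          rw [nf_symm, nf_zero _ _ _ _ _ _ (by omega)]; simp
      · intro i
        simp only
        split_ifs with hi
        · rw [h i hi, map_zero]
        · exact hg _
  have : Nat.card (WW (nf4 n r s t p)) = Nat.card (Fin m → ZMod 2) := by
    refine Nat.card_congr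
      { toFun := fun x k => x.1 ⟨2*r + 2*s + 2*t + p + k, by omega⟩
        invFun := fun y => ⟨fun i => if h : 2*r + 2*s + 2*t + p ≤ (i : ℕ) then
            y ⟨i - (2*r + 2*s + 2*t + p), by omega⟩ else 0, ?_⟩
        left_inv := ?_
        right_inv := ?_ }
    · rw [hmem]
      intro i hi
      rw [dif_neg (by omega)]
    · rintro ⟨x, hx⟩
      ext i
      simp only
      split_ifs with h
      · congr 1; ext; simp; omega
      · exact ((hmem x).1 hx i (by omega)).symm
    · intro y
      funext k
      simp
  rw [this]
  simp

theorem nf4_core (n r s t p : ℕ) (hn : 2*r + 2*s ≤ n) (F : Matrix (Fin n) (Fin n) (ZMod 4))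
    (hW : Nat.card (WW (nf4 n r s t p + 2 • (F + Fᵀ))) = Nat.card (WW (nf4 n r s t p))) :
    ∃ Q, Good4 Q ∧ Qᵀ * (nf4 n r s t p + 2 • (F + Fᵀ)) * Q = nf4 n r s t p := by
  refine core3 (Equiv.sumCompl (fun i : Fin n => (i : ℕ) < 2 * r + 2 * s)) _
    (Matrix.of fun i j => nf4 n r s t p i j)
    (Matrix.of fun i j => ((nfEntry r s t p i j / 2 : ℤ) : ZMod 4)) ?_ ?_ 
    (fun i => ⟨⟨tau (r + s) i, by have := i.2; unfold tau; split_ifs <;> omega⟩, 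
      by have := i.2; simp only; unfold tau; split_ifs <;> omega⟩) ?_ ?_ ?_ F hW
  · ext i j; simp only [transpose_apply, of_apply, nf4]; rw [nf_symm]
  · ext i j; simp only [transpose_apply, of_apply]; rw [nf_symm]
  · intro i
    ext
    exact tau_tau _ _
  · rintro ⟨i, hi⟩ ⟨j, hj⟩
    have := two_cast _ (if (j : ℕ) = tau (r + s) i then 1 else 0) (by
      rw [nf_top r s t p i j hi]; split_ifs <;> rfl)
    simp only [of_apply, nf4, this, Subtype.mk.injEq, Fin.ext_iff]
    split_ifs <;> simp
  · ext i j
    rcases i with ⟨i, hi⟩ | ⟨i, hi⟩ <;> rcases j with ⟨j, hj⟩ | ⟨j, hj⟩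
    · simp
    · simp [nf4, nf_off r s t p i j hi hj]
    · simp [nf4, nf_symm r s t p i j, nf_off r s t p j i hj hi]
    · have h2 : nfEntry r s t p i j = 2 * (nfEntry r s t p i j / 2) := by
        by_cases h : (i : ℕ) < 2 * r + 2 * s + 2 * t + p
        · rw [nf_bot r s t p i j (by omega) h]; split_ifs <;> simp
        · rw [nf_zero r s t p i j (by omega)]; simp
      simp only [submatrix_apply, Equiv.sumCompl_apply_inr, fromBlocks_apply₂₂, Matrix.smul_apply, of_apply, nf4]
      conv_lhs => rw [h2]
      rw [nsmul_eq_mul]; push_cast; rfl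

open Matrix in
/-- Lemma 2.9: two normal forms are congruent mod 4 iff the parameters m agree
and the associated 𝔽₂-quadratic forms are isomorphic. -/
theorem stmt_12 (n r s t p m r' s' t' p' m' : ℕ)
    (A A' : Matrix (Fin n) (Fin n) ℤ)
    (hsym : A.IsSymm) (hsym' : A'.IsSymm)
    (hn : n = 2*r + 2*s + 2*t + p + m)
    (hn' : n = 2*r' + 2*s' + 2*t' + p' + m')
    (hA : ∀ i j : Fin n,
      ((A i j : ℤ) : ZMod 4) = ((nfEntry r s t p (i : ℕ) (j : ℕ) : ℤ) : ZMod 4))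
    (hA' : ∀ i j : Fin n,
      ((A' i j : ℤ) : ZMod 4) = ((nfEntry r' s' t' p' (i : ℕ) (j : ℕ) : ℤ) : ZMod 4)) :
    (∃ P : Matrix (Fin n) (Fin n) ℤ, (P.det = 1 ∨ P.det = -1) ∧
        ∀ i j : Fin n, (((Pᵀ * A * P) i j : ℤ) : ZMod 4) = ((A' i j : ℤ) : ZMod 4))
      ↔ (m = m' ∧
          ∃ T : (Fin n → ZMod 2) ≃ₗ[ZMod 2] (Fin n → ZMod 2),
            ∀ x : Fin n → ZMod 2, qf A (T x) = qf A' x) := by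
  set M := nf4 n r s t p with hMdef
  set M' := nf4 n r' s' t' p' with hM'def
  have hAM : A.map (Int.castRingHom (ZMod 4)) = M := by ext i j; exact hA i j
  have hAM' : A'.map (Int.castRingHom (ZMod 4)) = M' := by ext i j; exact hA' i j
  have hMs : Mᵀ = M := nf4_symm _ _ _ _ _
  have hMs' : M'ᵀ = M' := nf4_symm _ _ _ _ _
  have hqf := qf_eq_iff A A' M M' hA hA' hMs (nf4_diag _ _ _ _ _) hMs' (nf4_diag _ _ _ _ _)
  have hW : Nat.card (WW M) = 2 ^ m := nf4_WW n r s t p m hn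
  have hW' : Nat.card (WW M') = 2 ^ m' := nf4_WW n r' s' t' p' m' hn'
  have key : (∃ P : Matrix (Fin n) (Fin n) ℤ, (P.det = 1 ∨ P.det = -1) ∧
        ∀ i j : Fin n, (((Pᵀ * A * P) i j : ℤ) : ZMod 4) = ((A' i j : ℤ) : ZMod 4)) ↔
      ∃ P : Matrix (Fin n) (Fin n) (ZMod 4), Good4 P ∧ Pᵀ * M * P = M' := by
    have hmap : ∀ P : Matrix (Fin n) (Fin n) ℤ, (Pᵀ * A * P).map (Int.castRingHom (ZMod 4)) =
        (P.map (Int.castRingHom (ZMod 4)))ᵀ * M * P.map (Int.castRingHom (ZMod 4)) := by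
      intro P
      rw [Matrix.map_mul, Matrix.map_mul, hAM, transpose_map]
    constructor
    · rintro ⟨P, hP, hPe⟩
      refine ⟨_, ⟨P, hP, rfl⟩, ?_⟩
      rw [← hmap, ← hAM']
      ext i j; exact hPe i j
    · rintro ⟨_, ⟨P, hP, rfl⟩, hPe⟩
      refine ⟨P, hP, ?_⟩
      rw [← hmap, ← hAM'] at hPe
      intro i j
      exact congrFun (congrFun hPe i) j
  have hval : ∀ (P N : Matrix (Fin n) (Fin n) (ZMod 4)) (y : Fin n → ZMod 4),
      (P *ᵥ y) ⬝ᵥ N *ᵥ (P *ᵥ y) = y ⬝ᵥ (Pᵀ * N * P) *ᵥ y := by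
    intro P N y
    rw [← mulVec_mulVec, ← mulVec_mulVec, dotProduct_mulVec y Pᵀ, vecMul_transpose]
  choose g hg using c42_surj
  rw [key]
  constructor
  · rintro ⟨P, hP, hPe⟩
    have hu := good_det hP
    refine ⟨?_, ?_⟩
    · have := WW_congr M P hu
      rw [hPe, hW, hW'] at this
      exact (Nat.pow_right_injective (le_refl 2) this).symm
    · have hdet : IsUnit (P.map c42).det := by
        have : (P.map c42).det = c42 P.det := by rw [RingHom.map_det]; rfl
        rw [this]; exact hu.map c42
      refine ⟨Matrix.toLinearEquiv' (P.map c42) (Matrix.invertibleOfIsUnitDet _ hdet), ?_⟩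
      intro x
      rw [hqf _ _ (P *ᵥ fun i => g (x i)) (fun i => g (x i)) ?_ (fun i => hg _), hval, hPe]
      intro i
      rw [c42_mulVec]
      simp only [hg]
      rfl
  · rintro ⟨rfl, T, hT⟩
    obtain ⟨P, hP, hPT⟩ := good_lift (LinearMap.toMatrix' (T : (Fin n → ZMod 2) →ₗ[ZMod 2] (Fin n → ZMod 2)))
      (by rw [LinearMap.det_toMatrix']; exact (LinearEquiv.isUnit_det' T).ne_zero)
    have hB : ∀ y, y ⬝ᵥ (Pᵀ * M * P) *ᵥ y = y ⬝ᵥ M' *ᵥ y := by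
      intro y
      rw [← hval]
      refine (hqf (T (fun i => c42 (y i))) (fun i => c42 (y i)) (P *ᵥ y) y ?_ (fun i => rfl)).1 (hT _)
      intro i
      rw [c42_mulVec, hPT, LinearMap.toMatrix'_mulVec]; rfl
    set C := Pᵀ * M * P - M' with hC
    have hCs : ∀ i j, C i j = C j i := by
      have : Cᵀ = C := by
        rw [hC, transpose_sub, transpose_mul, transpose_mul, hMs, hMs', transpose_transpose, mul_assoc]
      intro i j
      exact congrFun (congrFun this j) i
    have hC0 : ∀ y, y ⬝ᵥ C *ᵥ y = 0 := by
      intro y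
      rw [hC, sub_mulVec, dotProduct_sub, hB, sub_self]
    have hCd : ∀ i, C i i = 0 := by
      intro i
      simpa using hC0 (Pi.single i 1)
    have hCo : ∀ i j, 2 * C i j = 0 := by
      intro i j
      have := hC0 (Pi.single i 1 + Pi.single j 1)
      simp only [mulVec_add, dotProduct_add, add_dotProduct, mulVec_single_one, single_one_dotProduct, col_apply, hCd] at this
      rw [hCs j i] at this
      linear_combination this
    choose f hf using fun i j => half4 _ (hCo i j)
    let F : Matrix (Fin n) (Fin n) (ZMod 4) := Matrix.of fun i j => if i < j then f i j else 0
    have hF : Pᵀ * M * P = M' + 2 • (F + Fᵀ) := by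
      rw [← sub_eq_iff_eq_add', ← hC]
      ext i j
      simp only [Matrix.smul_apply, Matrix.add_apply, transpose_apply, F, of_apply, nsmul_eq_mul, Nat.cast_ofNat]
      rcases lt_trichotomy i j with h | h | h
      · simp [h, h.not_gt, hf i j]
      · subst h; simp [hCd]
      · simp [h, h.not_gt]
        rw [hCs, hf j i]
    obtain ⟨Q, hQ, hQe⟩ := nf4_core n r' s' t' p' (by omega) F (by
      rw [← hM'def, ← hF, WW_congr M P (good_det hP), hW, hW'])
    refine ⟨P * Q, good_mul hP hQ, ?_⟩
    rw [← hM'def, ← hF] at hQe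
    rw [← hQe, transpose_mul]
    simp only [mul_assoc]
end
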